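/- arXiv:1910.08202 — 2 statements merged into one kernel-verified Lean document; each statement's English description precedes it below -/
import Mathlib

section
/- For 0 < d < 1/2 and each fixed integer h ≥ 1, the ratio (∑_{t=1}^{T-h} r_t(d) r_{t+h}(d)) / (∑_{t=1}^T r_t(d)²) converges to 1 as T → ∞. -/
open Filter Finset MeasureTheory ProbabilityTheory Real

/-- Fractional-differencing coefficients: `π_0(d) = 1`,
`π_j(d) = π_{j-1}(d)·(j-1-d)/j` for `j ≥ 1`. -/
noncomputable def fracCoef (d : ℝ) : ℕ → ℝ
  | 0 => 1
  | j + 1 => fracCoef d j * (((j : ℝ) - d) / ((j : ℝ) + 1))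

/-- Partial sums `r_t(d) = ∑_{j=0}^{t-1} π_j(d)`. -/
noncomputable def rSum (d : ℝ) (t : ℕ) : ℝ := ∑ j ∈ Finset.range t, fracCoef d j

theorem fracCoef_succ_eq_rSum (d : ℝ) (t : ℕ) :
    fracCoef d (t + 1) = -(d / (t + 1)) * rSum d (t + 1) := by
  induction t with
  | zero => simp [fracCoef, rSum]
  | succ n ih =>
    have hr : rSum d (n + 1 + 1) = rSum d (n + 1) + fracCoef d (n + 1) :=
      Finset.sum_range_succ _ _
    have hf : fracCoef d (n + 1 + 1) =
        fracCoef d (n + 1) * (((n + 1 : ℕ) - d) / ((n + 1 : ℕ) + 1)) := rfl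
    rw [hr, hf, ih]
    push_cast
    field_simp
    ring

theorem rSum_one (d : ℝ) : rSum d 1 = 1 := by
  simp [rSum, fracCoef]

theorem rSum_add_two (d : ℝ) (t : ℕ) :
    rSum d (t + 2) = rSum d (t + 1) * (1 - d / (t + 1)) := by
  have hr : rSum d (t + 2) = rSum d (t + 1) + fracCoef d (t + 1) :=
    Finset.sum_range_succ _ _
  rw [hr, fracCoef_succ_eq_rSum]
  ring

theorem rSum_succ_pos {d : ℝ} (hd1 : d < 1) (t : ℕ) : 0 < rSum d (t + 1) := by
  induction t with
  | zero => simp [rSum_one]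
  | succ n ih =>
    rw [rSum_add_two]
    refine mul_pos ih (sub_pos.2 ?_)
    rw [div_lt_one (by positivity)]
    linarith [(Nat.cast_nonneg n : (0 : ℝ) ≤ n)]

theorem antitone_rSum_succ {d : ℝ} (hd0 : 0 ≤ d) (hd1 : d < 1) :
    Antitone fun t : ℕ => rSum d (t + 1) := by
  refine antitone_nat_of_succ_le fun n => ?_
  rw [rSum_add_two]
  refine mul_le_of_le_one_right (rSum_succ_pos hd1 n).le ?_
  have : 0 ≤ d / ((n : ℝ) + 1) := by positivity
  linarith

theorem sq_le_mul_rSum_sq {d : ℝ} (hd1 : d ≤ 1 / 2) (t : ℕ) :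
    (1 - d) ^ 2 ≤ ((t : ℝ) + 1) * rSum d (t + 2) ^ 2 := by
  induction t with
  | zero => simp [rSum_add_two, rSum_one]
  | succ n ih =>
    refine ih.trans ?_
    rw [rSum_add_two d (n + 1)]
    have key : (n : ℝ) + 1 ≤ ((n : ℝ) + 1 + 1) * (1 - d / ((n : ℝ) + 1 + 1)) ^ 2 := by
      have h0 : ((n : ℝ) + 1 + 1) * (1 - d / ((n : ℝ) + 1 + 1)) ^ 2 =
          (n : ℝ) + 2 - 2 * d + d ^ 2 / ((n : ℝ) + 1 + 1) := by
        field_simp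
        ring
      have h1 : 0 ≤ d ^ 2 / ((n : ℝ) + 1 + 1) := by positivity
      linarith
    push_cast
    calc ((n : ℝ) + 1) * rSum d (n + 2) ^ 2
        ≤ (((n : ℝ) + 1 + 1) * (1 - d / ((n : ℝ) + 1 + 1)) ^ 2) * rSum d (n + 2) ^ 2 := by
          gcongr
      _ = _ := by ring

theorem div_le_rSum_sq {d : ℝ} (hd0 : 0 ≤ d) (hd1 : d ≤ 1 / 2) (t : ℕ) :
    (1 - d) ^ 2 * (1 / ((t : ℝ) + 1)) ≤ rSum d (t + 1) ^ 2 := by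
  rw [mul_one_div, div_le_iff₀ (by positivity)]
  cases t with
  | zero =>
    simp only [zero_add, rSum_one]
    norm_num
    rw [abs_le]
    constructor <;> linarith
  | succ n =>
    have h1 := sq_le_mul_rSum_sq hd1 n
    have h2 := sq_nonneg (rSum d (n + 2))
    push_cast
    nlinarith

theorem tendsto_sum_rSum_sq_atTop {d : ℝ} (hd0 : 0 ≤ d) (hd1 : d ≤ 1 / 2) :
    Tendsto (fun T : ℕ => ∑ t ∈ Finset.range T, rSum d (t + 1) ^ 2) atTop atTop := by
  have hc : 0 < (1 - d) ^ 2 := by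
    have : 0 < 1 - d := by linarith
    positivity
  refine tendsto_atTop_mono (fun T => ?_)
    (Real.tendsto_sum_range_one_div_nat_succ_atTop.const_mul_atTop hc)
  rw [Finset.mul_sum]
  exact Finset.sum_le_sum fun t _ => div_le_rSum_sq hd0 hd1 t

theorem sum_Icc_one_eq_sum_range (f : ℕ → ℝ) (n : ℕ) :
    ∑ t ∈ Finset.Icc 1 n, f t = ∑ t ∈ Finset.range n, f (t + 1) := by
  rw [Finset.range_eq_Ico, Finset.sum_Ico_add' f 0 n 1]
  rfl

theorem cross_product_sum_ratio_tendsto_one (d : ℝ) (hd0 : 0 < d) (hd1 : d < 1 / 2)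
    (h : ℕ) (hh : 1 ≤ h) :
    Tendsto (fun T : ℕ =>
        (∑ t ∈ Finset.Icc 1 (T - h), rSum d t * rSum d (t + h)) /
        (∑ t ∈ Finset.Icc 1 T, (rSum d t) ^ 2))
      atTop (nhds 1) := by
  simp only [sum_Icc_one_eq_sum_range]
  have hpos := rSum_succ_pos (d := d) (by linarith)
  have hanti := antitone_rSum_succ hd0.le (by linarith : d < 1)
  have hle : ∀ t, rSum d (t + 1 + h) ≤ rSum d (t + 1) := fun t => by
    have := hanti (Nat.le_add_right t h)
    simpa only [add_right_comm t h 1] using this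
  have hnonneg : ∀ t, 0 ≤ rSum d (t + 1 + h) := fun t => by
    rw [add_right_comm]
    exact (hpos _).le
  have hD := tendsto_sum_rSum_sq_atTop hd0.le hd1.le
  have hlower : Tendsto (fun T : ℕ => 1 - (∑ t ∈ Finset.range h, rSum d (t + 1) ^ 2) /
      ∑ t ∈ Finset.range T, rSum d (t + 1) ^ 2) atTop (nhds 1) := by
    simpa using tendsto_const_nhds.sub (hD.const_div_atTop _)
  refine tendsto_of_tendsto_of_tendsto_of_le_of_le' hlower tendsto_const_nhds ?_ ?_
  · filter_upwards [hD.eventually_gt_atTop 0, eventually_ge_atTop h] with T hT hhT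
    rw [one_sub_div hT.ne']
    gcongr
    obtain ⟨m, rfl⟩ := Nat.exists_eq_add_of_le hhT
    rw [Finset.sum_range_add, add_sub_cancel_left, Nat.add_sub_cancel_left]
    refine Finset.sum_le_sum fun t _ => ?_
    rw [show h + t + 1 = t + 1 + h by ring, sq]
    exact mul_le_mul_of_nonneg_right (hle t) (hnonneg t)
  · filter_upwards [hD.eventually_gt_atTop 0] with T hT
    rw [div_le_one hT]
    calc ∑ t ∈ Finset.range (T - h), rSum d (t + 1) * rSum d (t + 1 + h)
        ≤ ∑ t ∈ Finset.range (T - h), rSum d (t + 1) ^ 2 := by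
          refine Finset.sum_le_sum fun t _ => ?_
          rw [sq]
          exact mul_le_mul_of_nonneg_left (hle t) (hpos t).le
      _ ≤ ∑ t ∈ Finset.range T, rSum d (t + 1) ^ 2 :=
          Finset.sum_le_sum_of_subset_of_nonneg (Finset.range_mono (Nat.sub_le T h))
            fun t _ _ => sq_nonneg _
end

section
/- For every real d with d > 1/2, the series ∑_{t=1}^∞ r_t(d)² converges (the sum of squared partial sums of the fractional-differencing coefficients remains finite as T grows). -/
open Filter Finset MeasureTheory ProbabilityTheory Real

/-- A nonnegative sequence that is eventually dominated by the decrements of a nonnegative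
sequence is summable. -/
theorem summable_of_le_sub_succ {a b : ℕ → ℝ} (N : ℕ) (ha : ∀ n, 0 ≤ a n) (hb : ∀ n, 0 ≤ b n)
    (h : ∀ n, N ≤ n → a n ≤ b n - b (n + 1)) : Summable a := by
  rw [← summable_nat_add_iff N]
  refine summable_of_sum_range_le (c := b N) (fun n => ha _) fun n => ?_
  suffices ∑ i ∈ Finset.range n, a (i + N) ≤ b N - b (n + N) by linarith [hb (n + N)]
  induction n with
  | zero => simp
  | succ n ih =>
    rw [Finset.sum_range_succ, Nat.add_right_comm n 1 N]
    linarith [h (n + N) (Nat.le_add_left N n)]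

theorem rSum_succ (d : ℝ) (t : ℕ) : rSum d (t + 1) = rSum d t + fracCoef d t :=
  Finset.sum_range_succ _ _

theorem natCast_mul_fracCoef (d : ℝ) (t : ℕ) : (t : ℝ) * fracCoef d t = -d * rSum d t := by
  induction t with
  | zero => simp [rSum]
  | succ t ih =>
    have ht : (t : ℝ) + 1 ≠ 0 := by positivity
    have hmul : ((t : ℝ) + 1) * fracCoef d (t + 1) = fracCoef d t * (t - d) := by
      simp only [fracCoef]
      field_simp
    rw [rSum_succ, Nat.cast_succ, hmul]
    linarith

theorem natCast_mul_rSum_succ (d : ℝ) (t : ℕ) :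
    (t : ℝ) * rSum d (t + 1) = (t - d) * rSum d t := by
  rw [rSum_succ, mul_add, natCast_mul_fracCoef]
  ring

theorem summable_rSum_sq (d : ℝ) (hd : 1 / 2 < d) :
    Summable (fun t : ℕ => (rSum d t) ^ 2) := by
  obtain ⟨N, hN⟩ := exists_nat_gt (2 * d ^ 2 / (2 * d - 1))
  have hc : 0 < 2 * d - 1 := by linarith
  suffices Summable fun t : ℕ => (2 * d - 1) / 2 * rSum d t ^ 2 from
    (summable_mul_left_iff (by positivity)).1 this
  refine summable_of_le_sub_succ (b := fun t => |(t : ℝ) - 1| * rSum d t ^ 2) N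
    (fun t => by positivity) (fun t => by positivity) fun t ht => ?_
  have hNt : 2 * d ^ 2 / (2 * d - 1) < t := hN.trans_le (Nat.cast_le.2 ht)
  have ht0 : (0 : ℝ) < t := lt_of_le_of_lt (by positivity) hNt
  have ht1 : (1 : ℝ) ≤ t := Nat.one_le_cast.2 (Nat.cast_pos.1 ht0)
  have hd2 : d ^ 2 / t ≤ (2 * d - 1) / 2 := by
    rw [div_lt_iff₀ hc] at hNt
    rw [div_le_iff₀ ht0]
    linarith
  have hstep : (t : ℝ) * rSum d (t + 1) ^ 2 = (t - 2 * d + d ^ 2 / t) * rSum d t ^ 2 := by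
    have hr : rSum d (t + 1) = (t - d) * rSum d t / t := by
      rw [← natCast_mul_rSum_succ, mul_div_cancel_left₀ _ ht0.ne']
    rw [hr]
    field_simp
    ring
  simp only [Nat.cast_succ, add_sub_cancel_right]
  rw [abs_of_nonneg (sub_nonneg.2 ht1), abs_of_pos ht0, hstep, ← sub_mul]
  gcongr
  linarith
end
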